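/- There exist Markovian statistics on four times, deduced via sharp projective measurements, that no memoryless quantum dynamics reproduces: there do NOT exist a density matrix ρ₁ ∈ Matrix (Fin 2) (Fin 2) ℂ and completely positive trace-preserving maps Λ_2, Λ_3, Λ_4 on Matrix (Fin 2) (Fin 2) ℂ (each given by a finite Kraus family) such that for all x_1, x_2, x_3, x_4 ∈ Fin 2 both (i) tr[𝒫^{x_4}(Λ_4(𝒫^{x_3}(Λ_3(𝒫^{x_2}(Λ_2(𝒫^{x_1}(ρ₁)))))))] = 1/8 if x_3 = 0 and 0 otherwise, and (ii) tr[𝒫^{x_4}(Λ_4(𝒫^{x_3}(Λ_3(Λ_2(𝒫^{x_1}(ρ₁))))))] = 1/2 if x_3 = 0 and x_4 = x_1, and 0 otherwise. -/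

import Mathlib

open Matrix ComplexOrder

noncomputable section

/-- Sharp projective measurement in the standard basis with outcome `x`:
`𝒫^x(A) = |x⟩⟨x| A |x⟩⟨x|`. -/
def measM (x : Fin 2) (A : Matrix (Fin 2) (Fin 2) ℂ) : Matrix (Fin 2) (Fin 2) ℂ :=
  Matrix.single x x 1 * A * Matrix.single x x 1

/-- A map on qubit matrices is completely positive and trace preserving, given by a
finite Kraus family: `Λ(A) = ∑ ℓ, L ℓ A (L ℓ)†` with `∑ ℓ, (L ℓ)† L ℓ = 1`. -/
def IsKrausCPTP (Λ : Matrix (Fin 2) (Fin 2) ℂ → Matrix (Fin 2) (Fin 2) ℂ) : Prop :=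
  ∃ (m : ℕ) (L : Fin m → Matrix (Fin 2) (Fin 2) ℂ),
    (∀ A, Λ A = ∑ ℓ, L ℓ * A * (L ℓ)ᴴ) ∧ (∑ ℓ, (L ℓ)ᴴ * L ℓ = 1)

/-- The measured matrix is a scalar multiple of the matrix unit. -/
lemma measM_eq_smul (x : Fin 2) (A : Matrix (Fin 2) (Fin 2) ℂ) :
    measM x A = A x x • Matrix.single x x 1 := by
  ext i j
  fin_cases x <;> fin_cases i <;> fin_cases j <;>
    simp [measM, Matrix.mul_apply, Matrix.single_apply]

/-- A Kraus map commutes with scalars. -/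
lemma IsKrausCPTP.map_smul {Λ : Matrix (Fin 2) (Fin 2) ℂ → Matrix (Fin 2) (Fin 2) ℂ}
    (h : IsKrausCPTP Λ) (c : ℂ) (A : Matrix (Fin 2) (Fin 2) ℂ) : Λ (c • A) = c • Λ A := by
  obtain ⟨m, L, hL, -⟩ := h
  simp [hL, Finset.smul_sum]

/-- After a sharp measurement the statistics factorize. -/
lemma trace_factor {Λ : Matrix (Fin 2) (Fin 2) ℂ → Matrix (Fin 2) (Fin 2) ℂ}
    (h : IsKrausCPTP Λ) (x y : Fin 2) (A : Matrix (Fin 2) (Fin 2) ℂ) :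
    (measM y (Λ (measM x A))).trace = A x x * (Λ (Matrix.single x x 1)) y y := by
  rw [measM_eq_smul x, h.map_smul, measM_eq_smul y]
  simp

/-- There exist Markovian statistics on four times, deduced via sharp projective
measurements, that no memoryless quantum dynamics reproduces: no density matrix `ρ₁`
and CPTP maps `Λ₂, Λ₃, Λ₄` satisfy both (i) the quantum-regression-formula
prediction when all four times are measured equals `1/8` if `x₃ = 0` and `0`
otherwise, and (ii) the prediction when time `t₂` is not measured equals `1/2`
if `x₃ = 0` and `x₄ = x₁`, and `0` otherwise. -/
theorem hidden_quantum_memory :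
    ¬ ∃ (ρ : Matrix (Fin 2) (Fin 2) ℂ)
        (Λ2 Λ3 Λ4 : Matrix (Fin 2) (Fin 2) ℂ → Matrix (Fin 2) (Fin 2) ℂ),
      ρ.PosSemidef ∧ ρ.trace = 1 ∧
      IsKrausCPTP Λ2 ∧ IsKrausCPTP Λ3 ∧ IsKrausCPTP Λ4 ∧
      ∀ x1 x2 x3 x4 : Fin 2,
        ((measM x4 (Λ4 (measM x3 (Λ3 (measM x2 (Λ2 (measM x1 ρ))))))).trace =
            if x3 = 0 then (1 / 8 : ℂ) else 0) ∧
        ((measM x4 (Λ4 (measM x3 (Λ3 (Λ2 (measM x1 ρ)))))).trace =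
            if x3 = 0 ∧ x4 = x1 then (1 / 2 : ℂ) else 0) := by
  rintro ⟨ρ, Λ2, Λ3, Λ4, -, -, -, -, h4, h⟩
  have h00 := (h 0 0 0 0).2
  have h01 := (h 0 0 0 1).2
  have h11 := (h 1 0 0 1).2
  rw [trace_factor h4] at h00 h01 h11
  simp only [Fin.isValue, and_self, if_true, one_ne_zero, and_false, if_false] at h00 h01 h11
  rcases mul_eq_zero.mp h01 with h' | h'
  · rw [h'] at h00
    norm_num at h00
  · rw [h'] at h11
    norm_num at h11
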